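/- Let 𝕋⁴ = (ℝ/ℤ)⁴ with the product (sup) metric, where ℝ/ℤ carries its quotient metric, and for t ∈ ℝ let [t] denote its class in ℝ/ℤ. Define the subsets X¹ = {p : p₁=[0] ∧ p₂=[0]} ∪ {p : p₃=[0] ∧ p₄=[0]}, X² = {p : p₁=[1/3] ∧ p₃=[1/3]} ∪ {p : p₂=[1/3] ∧ p₄=[1/3]}, and X³ = {p : p₁=[2/3] ∧ p₄=[2/3]} ∪ {p : p₂=[2/3] ∧ p₃=[2/3]} of 𝕋⁴. Then for every ε with 0 < ε < 1/6, the open ε-neighborhoods (ε-thickenings) of X¹, X², and X³ in 𝕋⁴ are pairwise disjoint. -/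

import Mathlib

open Set

/-- The flat 4-torus `(ℝ/ℤ)⁴` with the sup metric. -/
abbrev T4 : Type := Fin 4 → AddCircle (1 : ℝ)

/-- `X¹ = {t₁ = 0, t₂ = 0} ∪ {t₃ = 0, t₄ = 0}`. -/
def X1 : Set T4 :=
  {p | p 0 = ((0 : ℝ) : AddCircle (1 : ℝ)) ∧ p 1 = ((0 : ℝ) : AddCircle (1 : ℝ))} ∪
  {p | p 2 = ((0 : ℝ) : AddCircle (1 : ℝ)) ∧ p 3 = ((0 : ℝ) : AddCircle (1 : ℝ))}

/-- `X² = {t₁ = 1/3, t₃ = 1/3} ∪ {t₂ = 1/3, t₄ = 1/3}`. -/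
def X2 : Set T4 :=
  {p | p 0 = ((1/3 : ℝ) : AddCircle (1 : ℝ)) ∧ p 2 = ((1/3 : ℝ) : AddCircle (1 : ℝ))} ∪
  {p | p 1 = ((1/3 : ℝ) : AddCircle (1 : ℝ)) ∧ p 3 = ((1/3 : ℝ) : AddCircle (1 : ℝ))}

/-- `X³ = {t₁ = 2/3, t₄ = 2/3} ∪ {t₂ = 2/3, t₃ = 2/3}`. -/
def X3 : Set T4 :=
  {p | p 0 = ((2/3 : ℝ) : AddCircle (1 : ℝ)) ∧ p 3 = ((2/3 : ℝ) : AddCircle (1 : ℝ))} ∪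
  {p | p 1 = ((2/3 : ℝ) : AddCircle (1 : ℝ)) ∧ p 2 = ((2/3 : ℝ) : AddCircle (1 : ℝ))}


/-- Points of the circle whose lifts differ by a number in `[1/3, 2/3]` are at distance
at least `1/3`. -/
theorem circle_dist_ge (a b : ℝ) (h1 : 1/3 ≤ b - a) (h2 : b - a ≤ 2/3) :
    1/3 ≤ dist (a : AddCircle (1 : ℝ)) (b : AddCircle (1 : ℝ)) := by
  rw [dist_comm, dist_eq_norm, ← AddCircle.coe_sub, UnitAddCircle.norm_eq]
  rcases le_or_gt (round (b - a)) 0 with h | h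
  · have h' : (round (b - a) : ℝ) ≤ 0 := by exact_mod_cast h
    exact le_trans (by linarith) (le_abs_self _)
  · have h' : (1 : ℝ) ≤ (round (b - a) : ℝ) := by exact_mod_cast h
    exact le_trans (by linarith) (neg_le_abs _)

/-- Two sets whose points always differ by `1/3` in some coordinate have disjoint thickenings. -/
theorem disjoint_thickening_aux (ε : ℝ) (hε : ε < 1/6) (A B : Set T4)
    (h : ∀ p ∈ A, ∀ q ∈ B, ∃ k, 1/3 ≤ dist (p k) (q k)) :
    Disjoint (Metric.thickening ε A) (Metric.thickening ε B) := by
  rw [Set.disjoint_left]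
  intro x hA hB
  obtain ⟨p, hp, hxp⟩ := Metric.mem_thickening_iff.1 hA
  obtain ⟨q, hq, hxq⟩ := Metric.mem_thickening_iff.1 hB
  obtain ⟨k, hk⟩ := h p hp q hq
  have h1 := dist_le_pi_dist p q k
  have h2 := dist_triangle_left p q x
  linarith

theorem disjoint_12 (ε : ℝ) (hε : ε < 1/6) :
    Disjoint (Metric.thickening ε X1) (Metric.thickening ε X2) := by
  have key := circle_dist_ge 0 (1/3) (by norm_num) (by norm_num)
  apply disjoint_thickening_aux ε hε
  rintro p (⟨h, h'⟩ | ⟨h, h'⟩) q (⟨g, g'⟩ | ⟨g, g'⟩)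
  · exact ⟨0, by rw [h, g]; exact key⟩
  · exact ⟨1, by rw [h', g]; exact key⟩
  · exact ⟨2, by rw [h, g']; exact key⟩
  · exact ⟨3, by rw [h', g']; exact key⟩

theorem disjoint_13 (ε : ℝ) (hε : ε < 1/6) :
    Disjoint (Metric.thickening ε X1) (Metric.thickening ε X3) := by
  have key := circle_dist_ge 0 (2/3) (by norm_num) (by norm_num)
  apply disjoint_thickening_aux ε hε
  rintro p (⟨h, h'⟩ | ⟨h, h'⟩) q (⟨g, g'⟩ | ⟨g, g'⟩)
  · exact ⟨0, by rw [h, g]; exact key⟩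
  · exact ⟨1, by rw [h', g]; exact key⟩
  · exact ⟨3, by rw [h', g']; exact key⟩
  · exact ⟨2, by rw [h, g']; exact key⟩

theorem disjoint_23 (ε : ℝ) (hε : ε < 1/6) :
    Disjoint (Metric.thickening ε X2) (Metric.thickening ε X3) := by
  have key := circle_dist_ge (1/3) (2/3) (by norm_num) (by norm_num)
  apply disjoint_thickening_aux ε hε
  rintro p (⟨h, h'⟩ | ⟨h, h'⟩) q (⟨g, g'⟩ | ⟨g, g'⟩)
  · exact ⟨0, by rw [h, g]; exact key⟩
  · exact ⟨2, by rw [h', g']; exact key⟩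
  · exact ⟨3, by rw [h', g']; exact key⟩
  · exact ⟨1, by rw [h, g]; exact key⟩

/-- For `0 < ε < 1/6`, the open `ε`-neighborhoods of `X¹`, `X²`, `X³` in the flat 4-torus
are pairwise disjoint. -/
theorem thickenings_pairwise_disjoint (ε : ℝ) (hε0 : 0 < ε) (hε : ε < 1/6) :
    ∀ i j : Fin 3, i ≠ j →
      Disjoint (Metric.thickening ε (![X1, X2, X3] i))
        (Metric.thickening ε (![X1, X2, X3] j)) := by
  intro i j hij
  have h12 := disjoint_12 ε hε
  have h13 := disjoint_13 ε hε
  have h23 := disjoint_23 ε hε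
  fin_cases i <;> fin_cases j
  · exact absurd rfl hij
  · exact h12
  · exact h13
  · exact h12.symm
  · exact absurd rfl hij
  · exact h23
  · exact h13.symm
  · exact h23.symm
  · exact absurd rfl hij
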